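/- arXiv:1703.10498 — 3 statements merged into one kernel-verified Lean document; each statement's English description precedes it below -/
import Mathlib

section
/- Let M and N be countable ℵ₀-categorical structures (in countable first-order languages) with the strong small index property and no algebraicity (i.e. acl_M(A) = A and acl_N(A) = A for every finite A). Then Aut(M) and Aut(N) are isomorphic as abstract groups if and only if M and N are bi-definable. Moreover, for every abstract group isomorphism π : Aut(M) → Aut(N) there is a bijection f : M → N witnessing the bi-definability of M and N such that π(α) = f ∘ α ∘ f⁻¹ for every α ∈ Aut(M). -/
open FirstOrder Cardinal

namespace PaperSSIP

variable {L : FirstOrder.Language} {M : Type*} [L.Structure M]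

instance autGroup : Group (M ≃[L] M) where
  mul f g := f.comp g
  one := FirstOrder.Language.Equiv.refl L M
  inv := FirstOrder.Language.Equiv.symm
  mul_assoc f g h := by ext x; rfl
  one_mul f := by ext x; rfl
  mul_one f := by ext x; rfl
  inv_mul_cancel f := by
    ext x
    exact f.symm_apply_apply x

theorem mul_apply (f g : M ≃[L] M) (x : M) : (f * g) x = f (g x) := rfl

theorem one_apply (x : M) : (1 : M ≃[L] M) x = x := rfl

theorem inv_apply (f : M ≃[L] M) (x : M) : f⁻¹ x = f.symm x := rfl

/-- The pointwise stabilizer of a set. -/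
def ptStab (L : FirstOrder.Language) {M : Type*} [L.Structure M] (A : Set M) :
    Subgroup (M ≃[L] M) where
  carrier := {g | ∀ a ∈ A, g a = a}
  one_mem' := fun a _ => rfl
  mul_mem' := by
    intro f g hf hg a ha
    rw [mul_apply, hg a ha, hf a ha]
  inv_mem' := by
    intro f hf a ha
    rw [inv_apply]
    conv_lhs => rw [← hf a ha]
    exact f.symm_apply_apply a

/-- The setwise stabilizer of a set. -/
def setStab (L : FirstOrder.Language) {M : Type*} [L.Structure M] (A : Set M) :
    Subgroup (M ≃[L] M) where
  carrier := {g | g '' A = A}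
  one_mem' := by
    have : ⇑(1 : M ≃[L] M) = id := funext fun x => rfl
    simp only [Set.mem_setOf_eq, this, Set.image_id]
  mul_mem' := by
    intro f g hf hg
    have : ⇑(f * g) = ⇑f ∘ ⇑g := rfl
    simp only [Set.mem_setOf_eq] at *
    rw [this, Set.image_comp, hg, hf]
  inv_mem' := by
    intro f hf
    have h1 : ⇑f⁻¹ ∘ ⇑f = id := funext fun x => f.symm_apply_apply x
    simp only [Set.mem_setOf_eq] at *
    calc ⇑f⁻¹ '' A = ⇑f⁻¹ '' (⇑f '' A) := by rw [hf]
    _ = A := by rw [← Set.image_comp, h1, Set.image_id]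

/-- The orbit of a point under a subgroup of the automorphism group. -/
def orbit (H : Subgroup (M ≃[L] M)) (a : M) : Set M := {b | ∃ g ∈ H, g a = b}

/-- The algebraic closure of a set: points with finite orbit under the pointwise
stabilizer of the set. -/
def acl (L : FirstOrder.Language) {M : Type*} [L.Structure M] (A : Set M) : Set M :=
  {a | (orbit (ptStab L A) a).Finite}

/-- A subgroup has small index if its index is less than the continuum. -/
def SmallIndex (H : Subgroup (M ≃[L] M)) : Prop := #((M ≃[L] M) ⧸ H) < continuum

/-- The strong small index property. -/
def HasSSIP (L : FirstOrder.Language) (M : Type*) [L.Structure M] : Prop :=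
  ∀ H : Subgroup (M ≃[L] M), SmallIndex H →
    ∃ A : Set M, A.Finite ∧ ptStab L A ≤ H ∧ H ≤ setStab L A

/-- Locally finite algebraicity. -/
def LocFinAlg (L : FirstOrder.Language) (M : Type*) [L.Structure M] : Prop :=
  ∀ A : Set M, A.Finite → (acl L A).Finite

/-- Membership in `𝐀(M)`: being (the substructure carried by) the algebraic closure
of a finite set. -/
def memA (L : FirstOrder.Language) {M : Type*} [L.Structure M]
    (S : L.Substructure M) : Prop :=
  ∃ B : Set M, B.Finite ∧ (S : Set M) = acl L B

/-- `G_(K, L')`: automorphisms of `M` whose restriction to `K` lies in `L'`. -/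
def stabIn (S : L.Substructure M) (L' : Subgroup (↥S ≃[L] ↥S)) :
    Subgroup (M ≃[L] M) where
  carrier := {f | ∃ e ∈ L', ∀ x : S, f (x : M) = (e x : M)}
  one_mem' := ⟨1, L'.one_mem, fun _ => rfl⟩
  mul_mem' := by
    rintro f g ⟨ef, hef, hf⟩ ⟨eg, heg, hg⟩
    refine ⟨ef * eg, mul_mem hef heg, fun x => ?_⟩
    rw [mul_apply, hg x]
    exact hf (eg x)
  inv_mem' := by
    rintro f ⟨e, he, hfe⟩
    refine ⟨e⁻¹, inv_mem he, fun x => ?_⟩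
    have h1 : f ((e⁻¹ x : S) : M) = (x : M) := by
      rw [hfe (e⁻¹ x)]
      exact congrArg _ (e.apply_symm_apply x)
    have h2 : f (f⁻¹ (x : M)) = (x : M) := f.apply_symm_apply x
    exact EquivLike.injective f (h2.trans h1.symm)

/-- The family `𝒮𝒮(M)` of subgroups of the form `G_(K, L')`. -/
def SS (L : FirstOrder.Language) (M : Type*) [L.Structure M] :
    Set (Subgroup (M ≃[L] M)) :=
  {H | ∃ (S : L.Substructure M) (L' : Subgroup (↥S ≃[L] ↥S)), memA L S ∧ H = stabIn S L'}

/-- The family `𝒫𝒮(M)` of pointwise stabilizers of members of `𝐀(M)`. -/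
def PS (L : FirstOrder.Language) (M : Type*) [L.Structure M] :
    Set (Subgroup (M ≃[L] M)) :=
  {H | ∃ S : L.Substructure M, memA L S ∧ H = ptStab L (S : Set M)}


/-- Two structures are bi-definable via a bijection `f` if `f` maps `∅`-definable subsets of
`Mⁿ` exactly onto `∅`-definable subsets of `Nⁿ` (coordinatewise). -/
def IsBiDefinableVia (L₁ L₂ : FirstOrder.Language) {M N : Type*}
    [L₁.Structure M] [L₂.Structure N] (f : M ≃ N) : Prop :=
  ∀ (n : ℕ) (s : Set (Fin n → M)),
    Set.Definable (∅ : Set M) L₁ s ↔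
      Set.Definable (∅ : Set N) L₂ ((fun v => (f : M → N) ∘ v) '' s)

section ModelTheory

open FirstOrder.Language

/-- A monotone sequence starting at `p` and meeting each of countably many cofinal sets. -/
theorem exists_monotone_seq_mem {P : Type*} [Preorder P] (p : P) {ι : Type*} [Countable ι]
    (D : ι → Set P) (hD : ∀ i, ∀ q, ∃ r ∈ D i, q ≤ r) :
    ∃ s : ℕ → P, Monotone s ∧ s 0 = p ∧ ∀ i, ∃ n, s n ∈ D i := by
  have := Encodable.ofCountable ι
  let C : ι → Order.Cofinal P := fun i => ⟨D i, fun q => hD i q⟩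
  exact ⟨Order.sequenceOfCofinals p C, Order.sequenceOfCofinals.monotone p C, rfl,
    fun i => ⟨_, Order.sequenceOfCofinals.encode_mem p C i⟩⟩

/-- The type of the tuple `v` over `∅` is isolated by a single formula. -/
def IsIsolated (L : FirstOrder.Language) {M α : Type*} [L.Structure M] (v : α → M) : Prop :=
  ∃ θ : L.Formula α, θ.Realize v ∧
    ∀ χ : L.Formula α, χ.Realize v → ∀ w : α → M, θ.Realize w → χ.Realize w

/-- Two tuples have the same type over `∅`. -/
def SameType (L : FirstOrder.Language) {M α : Type*} [L.Structure M] (v w : α → M) : Prop :=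
  ∀ φ : L.Formula α, φ.Realize v ↔ φ.Realize w

theorem SameType.symm {α : Type*} {v w : α → M} (h : SameType L v w) : SameType L w v :=
  fun φ => (h φ).symm

theorem SameType.comp {α β : Type*} {v w : α → M} (h : SameType L v w) (e : β → α) :
    SameType L (v ∘ e) (w ∘ e) := fun φ => by
  simpa only [Formula.realize_relabel] using h (φ.relabel e)

theorem sameType_of_isolating {α : Type*} {v w : α → M} {θ : L.Formula α}
    (hθ : ∀ χ : L.Formula α, χ.Realize v → ∀ w : α → M, θ.Realize w → χ.Realize w)
    (hw : θ.Realize w) : SameType L v w := fun φ => by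
  refine ⟨fun h => hθ φ h w hw, fun h => ?_⟩
  by_contra hn
  exact (Formula.realize_not.1 (hθ φ.not (Formula.realize_not.2 hn) w hw)) h

theorem IsIsolated.of_sameType {α : Type*} {v w : α → M} (h : IsIsolated L v)
    (hvw : SameType L v w) : IsIsolated L w := by
  obtain ⟨θ, hθ, hi⟩ := h
  exact ⟨θ, (hvw θ).1 hθ, fun χ hχ => hi χ ((hvw χ).2 hχ)⟩

theorem IsIsolated.comp {α β : Type*} [Finite α] [Finite β] {v : α → M} (h : IsIsolated L v)
    (e : β → α) : IsIsolated L (v ∘ e) := by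
  obtain ⟨θ, hθ, hi⟩ := h
  let ρ : L.Formula (β ⊕ α) := θ.relabel Sum.inr ⊓
    Formula.iInf fun b : β => Term.equal (Term.var (Sum.inl b)) (Term.var (Sum.inr (e b)))
  have hρ : ∀ (y : β → M) (x : α → M), ρ.Realize (Sum.elim y x) ↔ θ.Realize x ∧ y = x ∘ e := by
    intro y x
    simp only [ρ, Formula.realize_inf, Formula.realize_relabel, Formula.realize_iInf,
      Formula.realize_equal, Term.realize_var, Sum.elim_inl, Sum.elim_inr, funext_iff,
      Sum.elim_comp_inr, Function.comp_apply]
  refine ⟨ρ.iExs α, Formula.realize_iExs.2 ⟨v, (hρ _ _).2 ⟨hθ, rfl⟩⟩, fun χ hχ w hw => ?_⟩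
  obtain ⟨x, hx⟩ := Formula.realize_iExs.1 hw
  obtain ⟨hx', rfl⟩ := (hρ _ _).1 hx
  exact Formula.realize_relabel.1 (hi (χ.relabel e) (Formula.realize_relabel.2 hχ) x hx')

theorem IsIsolated.of_elementaryEmbedding {M' α : Type*} [L.Structure M'] [Finite α]
    (j : M' ↪ₑ[L] M) {v : α → M'} (h : IsIsolated L (j ∘ v)) : IsIsolated L v := by
  obtain ⟨θ, hθ, hi⟩ := h
  refine ⟨θ, (j.map_formula θ v).1 hθ, fun χ hχ w hw => (j.map_formula χ w).1 ?_⟩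
  exact hi χ ((j.map_formula χ v).2 hχ) _ ((j.map_formula θ w).2 hw)

/-- A tuple with isolated type, one coordinate of which has been split off, is matched by an
extension of any tuple realizing the type of the remaining coordinates. -/
theorem exists_sameType_extension {α : Type*} [Finite α] {u w : α → M} (huw : SameType L u w)
    {a : M} (h : IsIsolated L (Sum.elim u fun _ : Unit => a)) :
    ∃ b, SameType L (Sum.elim u fun _ : Unit => a) (Sum.elim w fun _ : Unit => b) := by
  obtain ⟨θ, hθ, hi⟩ := h
  have h1 : (θ.iExs Unit).Realize u := Formula.realize_iExs.2 ⟨fun _ => a, hθ⟩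
  obtain ⟨x, hx⟩ := Formula.realize_iExs.1 ((huw _).1 h1)
  exact ⟨x (), sameType_of_isolating hi hx⟩

/-- A finite relation on `M` matching only tuples of the same type. -/
def IsElementaryRel (L : FirstOrder.Language) {M : Type*} [L.Structure M]
    (R : Set (M × M)) : Prop :=
  R.Finite ∧ ∀ (n : ℕ) (x y : Fin n → M), (∀ i, (x i, y i) ∈ R) → SameType L x y

theorem IsElementaryRel.sameType {R : Set (M × M)} (hR : IsElementaryRel L R) :
    SameType L (fun p : R => p.1.1) (fun p : R => p.1.2) := by
  have := hR.1.to_subtype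
  obtain ⟨n, ⟨e⟩⟩ := Finite.exists_equiv_fin R
  have h := (hR.2 n (fun i => (e.symm i).1.1) (fun i => (e.symm i).1.2)
    fun i => (e.symm i).2).comp e
  simpa only [Function.comp_def, Equiv.symm_apply_apply] using h

theorem IsElementaryRel.insert {R : Set (M × M)} (hR : IsElementaryRel L R) {a b : M}
    (h : SameType L (Sum.elim (fun p : R => p.1.1) fun _ : Unit => a)
      (Sum.elim (fun p : R => p.1.2) fun _ : Unit => b)) :
    IsElementaryRel L (insert (a, b) R) := by
  classical
  refine ⟨hR.1.insert _, fun n x y hxy => ?_⟩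
  let e : Fin n → R ⊕ Unit := fun i =>
    if hi : (x i, y i) ∈ R then Sum.inl ⟨_, hi⟩ else Sum.inr ()
  have hx : x = Sum.elim (fun p : R => p.1.1) (fun _ : Unit => a) ∘ e := by
    funext i
    by_cases hi : (x i, y i) ∈ R
    · simp [e, hi]
    · simpa [e, hi] using congrArg Prod.fst ((hxy i).resolve_right hi)
  have hy : y = Sum.elim (fun p : R => p.1.2) (fun _ : Unit => b) ∘ e := by
    funext i
    by_cases hi : (x i, y i) ∈ R
    · simp [e, hi]
    · simpa [e, hi] using congrArg Prod.snd ((hxy i).resolve_right hi)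
  rw [hx, hy]
  exact h.comp e

/-- A relation which is total on both sides and matches only tuples of the same type is the
graph of an automorphism. -/
theorem exists_equiv_of_rel {r : M → M → Prop} (h1 : ∀ a, ∃ b, r a b) (h2 : ∀ b, ∃ a, r a b)
    (hr : ∀ (n : ℕ) (x y : Fin n → M), (∀ i, r (x i) (y i)) → SameType L x y) :
    ∃ g : M ≃[L] M, ∀ a b, r a b → g a = b := by
  have key : ∀ a b a' b', r a b → r a' b' → (a = a' ↔ b = b') := by
    intro a b a' b' h h'
    have := hr 2 ![a, a'] ![b, b'] (by simp [Fin.forall_fin_two, h, h'])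
      (Term.equal (Term.var 0) (Term.var 1))
    simpa [Formula.realize_equal] using this
  choose g hg using h1
  choose g' hg' using h2
  refine ⟨⟨⟨g, g', ?_, ?_⟩, ?_, ?_⟩, fun a b hab => ?_⟩
  · exact fun a => (key _ _ _ _ (hg' (g a)) (hg a)).2 rfl
  · exact fun b => (key _ _ _ _ (hg (g' b)) (hg' b)).1 rfl
  · intro n f x
    have := hr (n + 1) (Fin.snoc x (Structure.funMap f x))
      (Fin.snoc (g ∘ x) (g (Structure.funMap f x)))
      (fun i => by refine Fin.lastCases ?_ (fun i => ?_) i <;> simp [hg])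
      (Term.equal (Term.func f fun i : Fin n => Term.var i.castSucc) (Term.var (Fin.last n)))
    simp only [Formula.realize_equal, Term.realize_func, Term.realize_var, Fin.snoc_castSucc,
      Fin.snoc_last, true_iff] at this
    exact this.symm
  · intro n R x
    have := hr n x (g ∘ x) (fun i => hg _) (R.formula fun i => Term.var i)
    simpa only [Formula.realize_rel, Term.realize_var] using this.symm
  · exact (key _ _ _ _ (hg a) hab).1 rfl

/-- Back and forth: in a countable structure in which all finite tuples have isolated types,
finite tuples of the same type are conjugate under the automorphism group. -/
theorem exists_equiv_of_sameType [Countable M]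
    (hM : ∀ (n : ℕ) (v : Fin n → M), IsIsolated L v)
    {n : ℕ} {u w : Fin n → M} (huw : SameType L u w) : ∃ g : M ≃[L] M, ∀ i, g (u i) = w i := by
  have hM' : ∀ (α : Type _) [Finite α] (v : α → M), IsIsolated L v := by
    intro α _ v
    obtain ⟨n, ⟨e⟩⟩ := Finite.exists_equiv_fin α
    have := (hM n (v ∘ e.symm)).comp e
    simpa only [Function.comp_assoc, Equiv.symm_comp_self, Function.comp_id] using this
  let D : M ⊕ M → Set {R : Set (M × M) // IsElementaryRel L R} :=
    Sum.elim (fun a => {R | ∃ b, (a, b) ∈ R.1}) (fun b => {R | ∃ a, (a, b) ∈ R.1})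
  have hD : ∀ i q, ∃ r ∈ D i, q ≤ r := by
    rintro (a | b) ⟨R, hR⟩
    all_goals have := hR.1.to_subtype
    · obtain ⟨b, hb⟩ := exists_sameType_extension hR.sameType (a := a) (hM' _ _)
      exact ⟨⟨_, hR.insert hb⟩, ⟨b, Set.mem_insert _ _⟩, Set.subset_insert _ _⟩
    · obtain ⟨a, ha⟩ := exists_sameType_extension hR.sameType.symm (a := b) (hM' _ _)
      exact ⟨⟨_, hR.insert ha.symm⟩, ⟨a, Set.mem_insert _ _⟩, Set.subset_insert _ _⟩
  have h0 : IsElementaryRel L (Set.range fun i => (u i, w i)) := by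
    refine ⟨Set.finite_range _, fun k x y hxy => ?_⟩
    choose e he using hxy
    have hx : x = u ∘ e := funext fun i => (congrArg Prod.fst (he i)).symm
    have hy : y = w ∘ e := funext fun i => (congrArg Prod.snd (he i)).symm
    rw [hx, hy]
    exact huw.comp e
  obtain ⟨s, hs, hs0, hsD⟩ := exists_monotone_seq_mem ⟨_, h0⟩ D hD
  obtain ⟨g, hg⟩ := exists_equiv_of_rel (L := L) (r := fun a b => ∃ k, (a, b) ∈ (s k).1)
    (fun a => (hsD (Sum.inl a)).elim fun k ⟨b, hb⟩ => ⟨b, k, hb⟩)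
    (fun b => (hsD (Sum.inr b)).elim fun k ⟨a, ha⟩ => ⟨a, k, ha⟩) (by
      intro k x y hxy
      choose m hm using hxy
      exact (s (Finset.univ.sup m)).2.2 k x y fun i =>
        hs (Finset.le_sup (Finset.mem_univ i)) (hm i))
  exact ⟨g, fun i => hg _ _ ⟨0, by rw [hs0]; exact ⟨i, rfl⟩⟩⟩

theorem exists_equiv_of_categorical {M A : Type} [L.Structure M] [L.Structure A]
    [Countable M] [Infinite M] [Countable A] [Infinite A] [A ⊨ L.completeTheory M]
    (hcat : (ℵ₀ : Cardinal).Categorical (L.completeTheory M)) : Nonempty (M ≃[L] A) := by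
  let M' := (Theory.ModelType.of (L.completeTheory M) M).ulift
  let A' := (Theory.ModelType.of (L.completeTheory M) A).ulift
  obtain ⟨e⟩ := hcat M' A'
    (by change #(ULift M) = _; rw [Cardinal.mk_uLift, Cardinal.mk_eq_aleph0 M]; simp)
    (by change #(ULift A) = _; rw [Cardinal.mk_uLift, Cardinal.mk_eq_aleph0 A]; simp)
  let eM : M ≃[L] M' := _root_.Equiv.inducedStructureEquiv _
  let eA : A ≃[L] A' := _root_.Equiv.inducedStructureEquiv _
  exact ⟨(eA.symm.comp e).comp eM⟩

/-- A countably categorical structure realizes every finitely satisfiable sequence of formulas. -/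
theorem exists_realize_of_categorical {M : Type} [L.Structure M] [Countable L.Symbols]
    [Countable M] [Infinite M] (hcat : (ℵ₀ : Cardinal).Categorical (L.completeTheory M))
    {α : Type*} [Finite α] (ψ : ℕ → L.Formula α)
    (hψ : ∀ k, ∃ v : α → M, ∀ j < k, (ψ j).Realize v) : ∃ v : α → M, ∀ j, (ψ j).Realize v := by
  choose v hv using hψ
  let U : Type := (Filter.hyperfilter ℕ : Filter ℕ).Product fun _ => M
  have hU : U ≅[L] M := elementarilyEquivalent_iff.2 fun φ => by
    simp [U, Ultraproduct.sentence_realize]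
  have : Infinite U := hU.infinite_iff.2 inferInstance
  let x : α → ℕ → M := fun a k => v k a
  let y : α → U := fun a => (x a : (Filter.hyperfilter ℕ : Filter ℕ).Product fun _ => M)
  have hy : ∀ j, (ψ j).Realize y := fun j => by
    refine (Ultraproduct.realize_formula_cast (ψ j) x).2 ?_
    have : ∀ᶠ k : ℕ in (Filter.hyperfilter ℕ : Filter ℕ), j < k :=
      Nat.hyperfilter_le_atTop (Filter.eventually_gt_atTop j)
    exact this.mono fun k hk => hv k j hk
  obtain ⟨S, hyS, hS⟩ := exists_elementarySubstructure_card_eq L (Set.range y) (ℵ₀ : Cardinal.{0}) le_rfl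
    (by simp)
    (by simpa only [Cardinal.lift_aleph0, Cardinal.lift_le_aleph0] using
      (show L.card ≤ ℵ₀ from Cardinal.mk_le_aleph0 (α := L.Symbols)))
    (by simp)
  have hS' : #S = ℵ₀ := by simpa using hS
  have : Countable S := Cardinal.mk_le_aleph0_iff.1 hS'.le
  have : Infinite S := Cardinal.infinite_iff.2 hS'.ge
  have : S ⊨ L.completeTheory M := (S.elementarilyEquivalent.trans hU).symm.theory_model
  obtain ⟨e⟩ := exists_equiv_of_categorical (A := S) hcat
  refine ⟨fun a => e.symm ⟨y a, hyS ⟨a, rfl⟩⟩, fun j => ?_⟩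
  refine (e.symm.toElementaryEmbedding.map_formula (ψ j) fun a => ⟨y a, hyS ⟨a, rfl⟩⟩).2 ?_
  exact (S.subtype.map_formula (ψ j) fun a => ⟨y a, hyS ⟨a, rfl⟩⟩).1 (hy j)

/-- In a countably categorical structure, isolated types are dense. -/
theorem exists_isIsolated {M : Type} [L.Structure M] [Countable L.Symbols]
    [Countable M] [Infinite M] (hcat : (ℵ₀ : Cardinal).Categorical (L.completeTheory M))
    {α : Type*} [Finite α] {φ : L.Formula α} {v : α → M} (hv : φ.Realize v) :
    ∃ w : α → M, φ.Realize w ∧ IsIsolated L w := by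
  by_contra! hcon
  obtain ⟨b, hb⟩ := exists_surjective_nat (α → M)
  let Q := {ψ : L.Formula α // (∃ w : α → M, ψ.Realize w) ∧ ∀ w : α → M, ψ.Realize w → φ.Realize w}
  have step : ∀ (q : Q) (z : α → M), ∃ q' : Q,
      (∀ w : α → M, q'.1.Realize w → q.1.Realize w) ∧ ¬ q'.1.Realize z := by
    rintro ⟨ψ, ⟨w, hw⟩, hψ⟩ z
    have hni := hcon w (hψ w hw)
    simp only [IsIsolated, not_exists, not_and, not_forall] at hni
    obtain ⟨χ, hχ, w', hw', hχ'⟩ := hni ψ hw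
    by_cases hz : χ.Realize z
    · exact ⟨⟨ψ ⊓ χ.not, ⟨w', by simp [hw', hχ']⟩,
        fun y hy => hψ y (Formula.realize_inf.1 hy).1⟩,
        fun y hy => (Formula.realize_inf.1 hy).1, by simp [hz]⟩
    · exact ⟨⟨ψ ⊓ χ, ⟨w, by simp [hw, hχ]⟩, fun y hy => hψ y (Formula.realize_inf.1 hy).1⟩,
        fun y hy => (Formula.realize_inf.1 hy).1, by simp [hz]⟩
  choose next hnext hnext' using step
  let s : ℕ → Q := fun k => Nat.rec ⟨φ, ⟨v, hv⟩, fun _ h => h⟩ (fun k q => next q (b k)) k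
  have hs : ∀ j k, j ≤ k → ∀ w : α → M, (s k).1.Realize w → (s j).1.Realize w := by
    intro j k hjk
    induction hjk with
    | refl => exact fun _ h => h
    | step _ ih => exact fun w hw => ih w (hnext _ _ w hw)
  obtain ⟨w, hw⟩ := exists_realize_of_categorical hcat (fun k => (s k).1) fun k =>
    (s k).2.1.imp fun w hw j hj => hs j k hj.le w hw
  obtain ⟨k, rfl⟩ := hb w
  exact hnext' (s k) (b k) (hw (k + 1))

theorem exists_isIsolated_extension {M : Type} [L.Structure M] [Countable L.Symbols]
    [Countable M] [Infinite M] (hcat : (ℵ₀ : Cardinal).Categorical (L.completeTheory M))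
    {α : Type*} [Finite α] {u : α → M} (hu : IsIsolated L u) {φ : L.Formula (α ⊕ Unit)} {a : M}
    (ha : φ.Realize (Sum.elim u fun _ => a)) :
    ∃ b, φ.Realize (Sum.elim u fun _ => b) ∧ IsIsolated L (Sum.elim u fun _ : Unit => b) := by
  obtain ⟨θ, hθ, hi⟩ := hu
  obtain ⟨w, hw, hwi⟩ := exists_isIsolated hcat (φ := θ.relabel Sum.inl ⊓ φ)
    (v := Sum.elim u fun _ => a) (by simp [ha, Formula.realize_relabel, hθ])
  obtain ⟨hw1, hw2⟩ := Formula.realize_inf.1 hw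
  have hsame := sameType_of_isolating hi (Formula.realize_relabel.1 hw1)
  have hw' : w = Sum.elim (w ∘ Sum.inl) fun _ : Unit => w (Sum.inr ()) := by
    funext i
    rcases i with i | i <;> rfl
  rw [hw'] at hwi hw2
  obtain ⟨b, hb⟩ := exists_sameType_extension hsame.symm hwi
  exact ⟨b, (hb φ).1 hw2, hwi.of_sameType hb⟩

/-- A finite set all of whose tuples have isolated types. -/
def IsAtomicSet (L : FirstOrder.Language) {M : Type*} [L.Structure M] (s : Set M) : Prop :=
  s.Finite ∧ ∀ (n : ℕ) (x : Fin n → M), (∀ i, x i ∈ s) → IsIsolated L x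

theorem IsAtomicSet.exists_insert {M : Type} [L.Structure M] [Countable L.Symbols]
    [Countable M] [Infinite M] (hcat : (ℵ₀ : Cardinal).Categorical (L.completeTheory M))
    {s : Set M} (hs : IsAtomicSet L s) {n : ℕ} {v : Fin n → M} (hv : ∀ i, v i ∈ s)
    {φ : L.Formula (Fin (n + 1))} {a : M} (ha : φ.Realize (Fin.snoc v a : Fin (n + 1) → M)) :
    ∃ b, φ.Realize (Fin.snoc v b : Fin (n + 1) → M) ∧ IsAtomicSet L (insert b s) := by
  classical
  have := hs.1.to_subtype
  have hu : IsIsolated L (Subtype.val : s → M) := by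
    obtain ⟨n, ⟨e⟩⟩ := Finite.exists_equiv_fin s
    have := (hs.2 n (fun i => (e.symm i).1) fun i => (e.symm i).2).comp e
    simpa only [Function.comp_def, Equiv.symm_apply_apply] using this
  let f : Fin (n + 1) → s ⊕ Unit :=
    Fin.snoc (α := fun _ => s ⊕ Unit) (fun i => Sum.inl ⟨v i, hv i⟩) (Sum.inr ())
  have hf : ∀ b, Sum.elim (Subtype.val : s → M) (fun _ : Unit => b) ∘ f = Fin.snoc v b := by
    intro b
    funext i
    refine Fin.lastCases ?_ (fun i => ?_) i <;> simp [f]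
  obtain ⟨b, hb, hbi⟩ := exists_isIsolated_extension hcat hu (φ := φ.relabel f) (a := a)
    (by rw [Formula.realize_relabel, hf]; exact ha)
  rw [Formula.realize_relabel, hf] at hb
  refine ⟨b, hb, hs.1.insert b, fun k x hx => ?_⟩
  let e : Fin k → s ⊕ Unit := fun i => if hi : x i ∈ s then Sum.inl ⟨x i, hi⟩ else Sum.inr ()
  have hxe : x = Sum.elim (Subtype.val : s → M) (fun _ : Unit => b) ∘ e := by
    funext i
    by_cases hi : x i ∈ s
    · simp [e, hi]
    · simpa [e, hi] using (hx i).resolve_right hi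
  rw [hxe]
  exact hbi.comp e

/-- A countably categorical structure has an elementary substructure in which every finite tuple
has isolated type. -/
theorem exists_atomic_elementarySubstructure {M : Type} [L.Structure M] [Countable L.Symbols]
    [Countable M] [Infinite M] (hcat : (ℵ₀ : Cardinal).Categorical (L.completeTheory M)) :
    ∃ S : L.ElementarySubstructure M,
      ∀ (n : ℕ) (x : Fin n → M), (∀ i, x i ∈ S) → IsIsolated L x := by
  let P := {s : Set M // IsAtomicSet L s}
  have h0 : IsAtomicSet L (∅ : Set M) := by
    refine ⟨Set.finite_empty, fun n x hx => ?_⟩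
    cases n with
    | succ n => exact (hx 0).elim
    | zero =>
      obtain ⟨w, -, hw⟩ := exists_isIsolated hcat (φ := ⊤) (v := x) (by simp)
      rwa [Subsingleton.elim x w]
  let D : (Σ n : ℕ, L.Formula (Fin (n + 1)) × (Fin n → M)) → Set P := fun i =>
    {s | (∀ b, ¬ i.2.1.Realize (Fin.snoc i.2.2 b : Fin (i.1 + 1) → M)) ∨
      (∃ b ∈ s.1, i.2.1.Realize (Fin.snoc i.2.2 b : Fin (i.1 + 1) → M)) ∨
      ∀ t : P, s ≤ t → ¬ ∀ k, i.2.2 k ∈ t.1}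
  have hD : ∀ i q, ∃ r ∈ D i, q ≤ r := by
    rintro ⟨n, φ, v⟩ q
    by_cases h : q ∈ D ⟨n, φ, v⟩
    · exact ⟨q, h, le_rfl⟩
    simp only [D, Set.mem_ofPred_eq, not_or, not_forall, not_not] at h
    obtain ⟨⟨a, ha⟩, -, ⟨t, ht, hvt⟩⟩ := h
    obtain ⟨b, hb, hbt⟩ := t.2.exists_insert hcat (by simpa using hvt) ha
    exact ⟨⟨_, hbt⟩, Or.inr (Or.inl ⟨b, Set.mem_insert _ _, hb⟩),
      ht.trans (Set.subset_insert _ _)⟩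
  obtain ⟨s, hs, -, hsD⟩ := exists_monotone_seq_mem (⟨∅, h0⟩ : P) D hD
  let A : Set M := ⋃ k, (s k).1
  have hA : ∀ {n : ℕ} (x : Fin n → M), (∀ i, x i ∈ A) → ∃ k, ∀ i, x i ∈ (s k).1 := by
    intro n x hx
    choose m hm using fun i => Set.mem_iUnion.1 (hx i)
    exact ⟨Finset.univ.sup m, fun i => hs (Finset.le_sup (Finset.mem_univ i)) (hm i)⟩
  have hwit : ∀ {n : ℕ} (φ : L.Formula (Fin (n + 1))) (x : Fin n → M), (∀ i, x i ∈ A) →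
      ∀ a, φ.Realize (Fin.snoc x a : Fin (n + 1) → M) →
      ∃ b ∈ A, φ.Realize (Fin.snoc x b : Fin (n + 1) → M) := by
    intro n φ x hx a ha
    obtain ⟨k, hk⟩ := hA x hx
    obtain ⟨m, h | ⟨b, hb, hφ⟩ | h⟩ := hsD ⟨n, φ, x⟩
    · exact (h a ha).elim
    · exact ⟨b, Set.mem_iUnion.2 ⟨m, hb⟩, hφ⟩
    · exact (h (s (max m k)) (hs (le_max_left _ _)) fun i => hs (le_max_right m k) (hk i)).elim
  let S : L.Substructure M := ⟨A, fun {n} f x hx => by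
    obtain ⟨b, hb, h⟩ := hwit
      (Term.equal (Term.func f fun i : Fin n => Term.var i.castSucc) (Term.var (Fin.last n)))
      x hx (Structure.funMap f x) (by simp [Formula.realize_equal])
    simp only [Formula.realize_equal, Term.realize_func, Term.realize_var, Fin.snoc_castSucc,
      Fin.snoc_last] at h
    rwa [h]⟩
  refine ⟨S.toElementarySubstructure fun n φ x a ha => ?_, fun n x hx => ?_⟩
  · have key : ∀ b, (φ.toFormula.relabel (Sum.elim Empty.elim id)).Realize
        (Fin.snoc (Subtype.val ∘ x) b : Fin (n + 1) → M) ↔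
        φ.Realize default (Fin.snoc (Subtype.val ∘ x) b : Fin (n + 1) → M) := by
      intro b
      rw [Formula.realize_relabel, BoundedFormula.realize_toFormula]
      exact iff_of_eq (congrArg₂ _ (Subsingleton.elim _ _) rfl)
    obtain ⟨b, hb, h⟩ := hwit _ (Subtype.val ∘ x) (fun i => (x i).2) a ((key a).2 ha)
    exact ⟨⟨b, hb⟩, (key b).1 h⟩
  · obtain ⟨k, hk⟩ := hA x hx
    exact (s k).2.2 n x hk

theorem isIsolated_of_categorical {M : Type} [L.Structure M] [Countable L.Symbols]
    [Countable M] [Infinite M] (hcat : (ℵ₀ : Cardinal).Categorical (L.completeTheory M))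
    {n : ℕ} (v : Fin n → M) : IsIsolated L v := by
  obtain ⟨S, hS⟩ := exists_atomic_elementarySubstructure hcat
  have : Infinite S := S.elementarilyEquivalent.infinite_iff.2 inferInstance
  have : Countable S := Subtype.countable
  obtain ⟨e⟩ := exists_equiv_of_categorical (A := S) hcat
  exact IsIsolated.of_elementaryEmbedding (S.subtype.comp e.toElementaryEmbedding)
    (hS n _ fun i => (e (v i)).2)

/-- Ryll-Nardzewski: in a countably categorical structure, invariant sets of finite tuples are
definable without parameters. -/
theorem definable_of_invariant {M : Type} [L.Structure M] [Countable L.Symbols]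
    [Countable M] [Infinite M] (hcat : (ℵ₀ : Cardinal).Categorical (L.completeTheory M))
    {n : ℕ} {s : Set (Fin n → M)} (hs : ∀ (g : M ≃[L] M), ∀ v ∈ s, ⇑g ∘ v ∈ s) :
    Set.Definable (∅ : Set M) L s := by
  classical
  have hiso : ∀ v : Fin n → M, IsIsolated L v := fun v => isIsolated_of_categorical hcat v
  choose θ hθ hi using hiso
  obtain ⟨b, hb⟩ := exists_surjective_nat (Fin n → M)
  obtain ⟨k, hk⟩ : ∃ k, ∀ v : Fin n → M, ∃ j < k, (θ (b j)).Realize v := by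
    by_contra! hcon
    obtain ⟨v, hv⟩ := exists_realize_of_categorical hcat (fun j => (θ (b j)).not)
      fun k => (hcon k).imp fun v hv j hj => Formula.realize_not.2 (hv j hj)
    obtain ⟨j, rfl⟩ := hb v
    exact Formula.realize_not.1 (hv j) (hθ (b j))
  refine Set.empty_definable_iff.2
    ⟨Formula.iSup fun j : {j : Fin k // b j ∈ s} => θ (b j), Set.ext fun v => ?_⟩
  simp only [Set.mem_ofPred_eq, Formula.realize_iSup, Subtype.exists, exists_prop]
  have hconj : ∀ {u w : Fin n → M}, (θ u).Realize w → (u ∈ s ↔ w ∈ s) := by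
    intro u w huw
    have hsame := sameType_of_isolating (hi u) huw
    have aux : ∀ {u w : Fin n → M}, SameType L u w → u ∈ s → w ∈ s := by
      intro u w h hu
      obtain ⟨g, hg⟩ := exists_equiv_of_sameType
        (fun n v => isIsolated_of_categorical hcat v) h
      rw [← show ⇑g ∘ u = w from funext hg]
      exact hs g u hu
    exact ⟨aux hsame, aux hsame.symm⟩
  constructor
  · intro hv
    obtain ⟨j, hj, h⟩ := hk v
    exact ⟨⟨j, hj⟩, (hconj h).2 hv, h⟩
  · rintro ⟨j, hj, h⟩
    exact (hconj h).1 hj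

theorem invariant_of_definable {n : ℕ} {s : Set (Fin n → M)}
    (hs : Set.Definable (∅ : Set M) L s) (g : M ≃[L] M) {v : Fin n → M} :
    ⇑g ∘ v ∈ s ↔ v ∈ s := by
  obtain ⟨φ, rfl⟩ := Set.empty_definable_iff.1 hs
  exact g.toElementaryEmbedding.map_formula φ v

end ModelTheory

section SmallIndex

variable {L₁ L₂ : FirstOrder.Language} {N : Type*} [L₂.Structure N]

theorem mem_ptStab {A : Set M} {g : M ≃[L] M} : g ∈ ptStab L A ↔ ∀ a ∈ A, g a = a := Iff.rfl

theorem mem_ptStab_singleton {a : M} {g : M ≃[L] M} : g ∈ ptStab L {a} ↔ g a = a := by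
  simp [mem_ptStab]

theorem smallIndex_comap_ptStab {M N : Type} [L₁.Structure M] [L₂.Structure N] [Countable N]
    (π : (M ≃[L₁] M) ≃* (N ≃[L₂] N)) {B : Set N} (hB : B.Finite) :
    SmallIndex ((ptStab L₂ B).comap π.toMonoidHom) := by
  have := hB.to_subtype
  let F : (M ≃[L₁] M) ⧸ (ptStab L₂ B).comap π.toMonoidHom → B → N := fun q b => π q.out b
  have hF : Function.Injective F := by
    intro p q hpq
    rw [← p.out_eq, ← q.out_eq]
    refine QuotientGroup.eq.2 fun b hb => ?_
    change π (p.out⁻¹ * q.out) b = b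
    rw [map_mul, map_inv, mul_apply, inv_apply, ← show π p.out b = π q.out b from
      congrFun hpq ⟨b, hb⟩]
    exact (π p.out).symm_apply_apply b
  have := hF.countable
  exact (Cardinal.mk_le_aleph0).trans_lt Cardinal.aleph0_lt_continuum

/-- A point fixed by the pointwise stabilizer of a finite set `A` lies in `A`, provided there is
no algebraicity. -/
theorem mem_of_finite_orbit (hM : ∀ A : Set M, A.Finite → acl L A = A) {A : Set M}
    (hA : A.Finite) {x : M} {t : Set M} (ht : t.Finite)
    (h : ∀ g ∈ ptStab L A, g x ∈ t) : x ∈ A := by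
  rw [← hM A hA]
  refine ht.subset ?_
  rintro _ ⟨g, hg, rfl⟩
  exact h g hg

/-- A group isomorphism carries the stabilizer of a point to the pointwise stabilizer of a finite
set. -/
theorem exists_ptStab_eq {M N : Type} [L₁.Structure M] [L₂.Structure N] [Countable M] [Countable N]
    (hM1 : HasSSIP L₁ M) (hM2 : ∀ A : Set M, A.Finite → acl L₁ A = A) (hN1 : HasSSIP L₂ N)
    (π : (M ≃[L₁] M) ≃* (N ≃[L₂] N)) (a : M) :
    ∃ B : Set N, B.Finite ∧ ∀ g, g a = a ↔ π g ∈ ptStab L₂ B := by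
  obtain ⟨B, hB, hBH, hHB⟩ := hN1 _ (smallIndex_comap_ptStab π.symm (Set.finite_singleton a))
  obtain ⟨A, hA, hAK, hKA⟩ := hM1 _ (smallIndex_comap_ptStab π hB)
  have hKa : ∀ g, π g ∈ ptStab L₂ B → g a = a := fun g hg => by
    have : π.symm (π g) ∈ ptStab L₁ {a} := hBH hg
    rwa [π.symm_apply_apply, mem_ptStab_singleton] at this
  have haB : ∀ g, g a = a → π g '' B = B := fun g hg => hHB (x := π g) (by
    change π.symm (π g) ∈ ptStab L₁ {a}
    rwa [π.symm_apply_apply, mem_ptStab_singleton])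
  have haA : a ∈ A := mem_of_finite_orbit hM2 hA (Set.finite_singleton a) fun g hg =>
    hKa g (hAK hg)
  have hAa : A ⊆ {a} := by
    intro x hx
    have := hB.to_subtype
    let r : (M ≃[L₁] M) → B → N := fun g b => π g b
    have hfin : (r '' {g | g a = a}).Finite := by
      refine (Set.Finite.pi' fun _ : B => hB).subset ?_
      rintro _ ⟨g, hg, rfl⟩ b
      rw [← haB g hg]
      exact Set.mem_image_of_mem _ b.2
    have hA' : ∀ g h, r g = r h → h x ∈ g '' A := by
      intro g h hgh
      have hK : g⁻¹ * h ∈ (ptStab L₂ B).comap π.toMonoidHom := by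
        intro b hb
        change π (g⁻¹ * h) b = b
        rw [map_mul, map_inv, mul_apply, inv_apply, ← show π g b = π h b from
          congrFun hgh ⟨b, hb⟩]
        exact (π g).symm_apply_apply b
      have := hKA hK
      refine ⟨(g⁻¹ * h) x, ?_, g.apply_symm_apply (h x)⟩
      rw [← show (g⁻¹ * h) '' A = A from this]
      exact Set.mem_image_of_mem _ hx
    refine mem_of_finite_orbit hM2 (Set.finite_singleton a)
      (hfin.biUnion (t := fun ρ => {y | ∃ g, r g = ρ ∧ g x = y}) fun ρ hρ => ?_) fun g hg =>
        Set.mem_biUnion ⟨g, mem_ptStab_singleton.1 hg, rfl⟩ ⟨g, rfl, rfl⟩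
    obtain ⟨g, -, rfl⟩ := hρ
    refine (hA.image g).subset ?_
    rintro _ ⟨h, hh, rfl⟩
    exact hA' g h hh.symm
  have hAa' : A = {a} := hAa.antisymm (Set.singleton_subset_iff.2 haA)
  exact ⟨B, hB, fun g => ⟨fun hg => hAK (by rwa [hAa', mem_ptStab_singleton]), hKa g⟩⟩


/-- A group isomorphism carries point stabilizers to point stabilizers. -/
theorem exists_fixes_iff {M N : Type} [L₁.Structure M] [L₂.Structure N] [Countable M] [Countable N]
    (hM1 : HasSSIP L₁ M) (hM2 : ∀ A : Set M, A.Finite → acl L₁ A = A)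
    (hN1 : HasSSIP L₂ N) (hN2 : ∀ A : Set N, A.Finite → acl L₂ A = A)
    (π : (M ≃[L₁] M) ≃* (N ≃[L₂] N)) (a : M) :
    ∃ b : N, ∀ g, g a = a ↔ π g b = b := by
  obtain ⟨B, hB, hBa⟩ := exists_ptStab_eq hM1 hM2 hN1 π a
  obtain ⟨b, hb⟩ : B.Nonempty := by
    rw [Set.nonempty_iff_ne_empty]
    rintro rfl
    exact mem_of_finite_orbit hM2 Set.finite_empty (Set.finite_singleton a) fun g _ =>
      (hBa g).2 fun _ h => h.elim
  obtain ⟨A, hA, hAb⟩ := exists_ptStab_eq hN1 hN2 hM1 π.symm b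
  obtain ⟨c, hc⟩ : A.Nonempty := by
    rw [Set.nonempty_iff_ne_empty]
    rintro rfl
    exact mem_of_finite_orbit hN2 Set.finite_empty (Set.finite_singleton b) fun g _ =>
      (hAb g).2 fun _ h => h.elim
  have hAb' : ∀ g, π g b = b ↔ g ∈ ptStab L₁ A := fun g => by
    rw [hAb, π.symm_apply_apply]
  have haA : ∀ x ∈ A, x = a := fun x hx =>
    mem_of_finite_orbit hM2 (Set.finite_singleton a) (Set.finite_singleton x) fun g hg =>
      (hAb' g).1 ((hBa g).1 (mem_ptStab_singleton.1 hg) b hb) x hx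
  refine ⟨b, fun g => ⟨fun hg => (hBa g).1 hg b hb, fun hg => ?_⟩⟩
  rw [← haA c hc]
  exact (hAb' g).1 hg c hc

/-- Without algebraicity, points are determined by their stabilizers. -/
theorem eq_of_fixes (hM : ∀ A : Set M, A.Finite → acl L A = A) {a b : M}
    (h : ∀ g : M ≃[L] M, g a = a → g b = b) : b = a :=
  mem_of_finite_orbit hM (Set.finite_singleton a) (Set.finite_singleton b) fun g hg =>
    h g (mem_ptStab_singleton.1 hg)

/-- Every group isomorphism is induced by an equivariant bijection. -/
theorem exists_equivariant_equiv {M N : Type} [L₁.Structure M] [L₂.Structure N]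
    [Countable M] [Countable N]
    (hM1 : HasSSIP L₁ M) (hM2 : ∀ A : Set M, A.Finite → acl L₁ A = A)
    (hN1 : HasSSIP L₂ N) (hN2 : ∀ A : Set N, A.Finite → acl L₂ A = A)
    (π : (M ≃[L₁] M) ≃* (N ≃[L₂] N)) :
    ∃ f : M ≃ N, ∀ (α : M ≃[L₁] M) (x : M), π α (f x) = f (α x) := by
  choose f hf using exists_fixes_iff hM1 hM2 hN1 hN2 π
  choose k hk using exists_fixes_iff hN1 hN2 hM1 hM2 π.symm
  have hk' : ∀ b g, π g b = b ↔ g (k b) = k b := fun b g => by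
    rw [hk, π.symm_apply_apply]
  have hleft : ∀ a, k (f a) = a := fun a =>
    eq_of_fixes hM2 fun g hg => (hk' _ g).1 ((hf a g).1 hg)
  have hright : ∀ b, f (k b) = b := fun b => eq_of_fixes hN2 fun g hg => by
    have := (hf (k b) (π.symm g)).1 ((hk b g).1 hg)
    rwa [π.apply_symm_apply] at this
  refine ⟨⟨f, k, hleft, hright⟩, fun α x => eq_of_fixes hN2 fun g hg => ?_⟩
  have h : (π α)⁻¹ (g (π α (f x))) = f x := by
    have h1 : π.symm g (α x) = α x := by
      rw [hf, π.apply_symm_apply]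
      exact hg
    have h2 := (hf x (α⁻¹ * π.symm g * α)).1 (by
      rw [mul_apply, mul_apply, h1]
      exact α.symm_apply_apply x)
    rwa [map_mul, map_mul, map_inv, π.apply_symm_apply] at h2
  exact ((π α).apply_symm_apply _).symm.trans (congrArg (π α) h)

theorem definable_of_isEmpty [IsEmpty M] {n : ℕ} (s : Set (Fin n → M)) :
    Set.Definable (∅ : Set M) L s := by
  rcases Set.eq_empty_or_nonempty s with rfl | ⟨v, hv⟩
  · exact Set.definable_empty
  · rw [show s = Set.univ from Set.eq_univ_of_forall fun w => Subsingleton.elim v w ▸ hv]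
    exact Set.definable_univ

/-- A group isomorphism induced by a bijection makes it a bi-definition. -/
theorem isBiDefinableVia_of_equivariant {M N : Type} [L₁.Structure M] [L₂.Structure N]
    [Countable M] [Countable N] [Countable L₁.Symbols] [Countable L₂.Symbols]
    (hMcat : (ℵ₀ : Cardinal).Categorical (L₁.completeTheory M))
    (hNcat : (ℵ₀ : Cardinal).Categorical (L₂.completeTheory N))
    (hM : acl L₁ (∅ : Set M) = ∅)
    (π : (M ≃[L₁] M) ≃* (N ≃[L₂] N)) (f : M ≃ N)
    (hf : ∀ (α : M ≃[L₁] M) (x : M), π α (f x) = f (α x)) : IsBiDefinableVia L₁ L₂ f := by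
  intro n s
  rcases finite_or_infinite M with hfin | hinf
  · have hempty : IsEmpty M := ⟨fun x => by
      have : x ∈ acl L₁ (∅ : Set M) := Set.toFinite _
      rwa [hM] at this⟩
    have : IsEmpty N := f.symm.isEmpty
    exact iff_of_true (definable_of_isEmpty _) (definable_of_isEmpty _)
  · have : Infinite N := f.infinite_iff.1 hinf
    constructor
    · refine fun hs => definable_of_invariant hNcat ?_
      rintro g _ ⟨v, hv, rfl⟩
      refine ⟨⇑(π.symm g) ∘ v, (invariant_of_definable hs _).2 hv, funext fun i => ?_⟩
      change f (π.symm g (v i)) = g (f (v i))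
      rw [← hf, π.apply_symm_apply]
    · refine fun hs => definable_of_invariant hMcat fun g v hv => ?_
      have := (invariant_of_definable hs (π g)).2 (Set.mem_image_of_mem _ hv)
      obtain ⟨w, hw, hwv⟩ := this
      convert hw
      funext i
      refine f.injective ?_
      exact (hf g (v i)).symm.trans (congrFun hwv i).symm

/-- A permutation preserving all sets definable without parameters is an automorphism. -/
def equivOfDefinable (h : M ≃ M) (hh : ∀ (n : ℕ) (s : Set (Fin n → M)),
    Set.Definable (∅ : Set M) L s → ∀ v, ⇑h ∘ v ∈ s ↔ v ∈ s) : M ≃[L] M where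
  toEquiv := h
  map_fun' {n} F v := by
    have := (hh (n + 1) {w | (FirstOrder.Language.Term.equal
      (.func F fun i => .var i.castSucc) (.var (Fin.last n)) : L.Formula (Fin (n + 1))).Realize w}
      (Set.empty_definable_iff.2 ⟨_, rfl⟩)
      (Fin.snoc v (FirstOrder.Language.Structure.funMap F v))).2
      (by simp [FirstOrder.Language.Formula.realize_equal])
    simpa [FirstOrder.Language.Formula.realize_equal, Function.comp_def, eq_comm] using this
  map_rel' {n} R v := by
    have := hh n {w | FirstOrder.Language.Structure.RelMap R w} (Set.empty_definable_iff.2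
      ⟨R.formula fun i => .var i, by ext; simp [FirstOrder.Language.Formula.realize_rel]⟩) v
    exact this

/-- Bi-definable structures have isomorphic automorphism groups. -/
theorem nonempty_mulEquiv_of_isBiDefinableVia {f : M ≃ N} (hf : IsBiDefinableVia L L₂ f) :
    Nonempty ((M ≃[L] M) ≃* (N ≃[L₂] N)) := by
  have h₁ : ∀ (g : M ≃[L] M) (n : ℕ) (s : Set (Fin n → N)), Set.Definable (∅ : Set N) L₂ s →
      ∀ v, ⇑((f.symm.trans g.toEquiv).trans f) ∘ v ∈ s ↔ v ∈ s := by
    intro g n s hs v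
    have hs' : Set.Definable (∅ : Set M) L ((fun v => f ∘ v) ⁻¹' s) := by
      rw [hf n, Set.image_preimage_eq]
      · exact hs
      · exact fun v => ⟨f.symm ∘ v, funext fun i => f.apply_symm_apply _⟩
    exact (invariant_of_definable hs' g (v := f.symm ∘ v)).trans
      (iff_of_eq (congrArg (· ∈ s) (funext fun i => f.apply_symm_apply (v i))))
  have h₂ : ∀ (g : N ≃[L₂] N) (n : ℕ) (s : Set (Fin n → M)), Set.Definable (∅ : Set M) L s →
      ∀ v, ⇑((f.trans g.toEquiv).trans f.symm) ∘ v ∈ s ↔ v ∈ s := by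
    intro g n s hs v
    have hinv := invariant_of_definable ((hf n s).1 hs) g (v := f ∘ v)
    have himg : ∀ w : Fin n → N, w ∈ (fun v => f ∘ v) '' s ↔ f.symm ∘ w ∈ s := by
      intro w
      constructor
      · rintro ⟨v, hv, rfl⟩
        simpa [Function.comp_def] using hv
      · exact fun hw => ⟨_, hw, funext fun i => f.apply_symm_apply _⟩
    rw [himg, himg] at hinv
    exact hinv.trans (iff_of_eq (congrArg (· ∈ s) (funext fun i => f.symm_apply_apply (v i))))
  exact ⟨{
    toFun g := equivOfDefinable _ (h₁ g)
    invFun g := equivOfDefinable _ (h₂ g)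
    left_inv g := by
      ext x
      change f.symm (f (g (f.symm (f x)))) = g x
      simp
    right_inv g := by
      ext x
      change f (f.symm (g (f (f.symm x)))) = g x
      simp
    map_mul' g h := by
      ext x
      change f (g (h (f.symm x))) = f (g (f.symm (f (h (f.symm x)))))
      simp }⟩

end SmallIndex

/-- For countable ℵ₀-categorical structures with the strong small index
property and no algebraicity, `Aut(M) ≅ Aut(N)` iff `M` and `N` are bi-definable; moreover
every abstract isomorphism `π` is induced by a bijection witnessing bi-definability. -/
theorem statement_2 {L₁ L₂ : FirstOrder.Language} {M N : Type}
    [L₁.Structure M] [L₂.Structure N]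
    [Countable M] [Countable N] [Countable L₁.Symbols] [Countable L₂.Symbols]
    (hMcat : (ℵ₀ : Cardinal).Categorical (L₁.completeTheory M))
    (hNcat : (ℵ₀ : Cardinal).Categorical (L₂.completeTheory N))
    (hM1 : HasSSIP L₁ M) (hM2 : ∀ A : Set M, A.Finite → acl L₁ A = A)
    (hN1 : HasSSIP L₂ N) (hN2 : ∀ A : Set N, A.Finite → acl L₂ A = A) :
    (Nonempty ((M ≃[L₁] M) ≃* (N ≃[L₂] N)) ↔ ∃ f : M ≃ N, IsBiDefinableVia L₁ L₂ f) ∧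
      ∀ π : (M ≃[L₁] M) ≃* (N ≃[L₂] N),
        ∃ f : M ≃ N, IsBiDefinableVia L₁ L₂ f ∧
          ∀ (α : M ≃[L₁] M) (x : M), π α (f x) = f (α x) := by
  have key : ∀ π : (M ≃[L₁] M) ≃* (N ≃[L₂] N),
      ∃ f : M ≃ N, IsBiDefinableVia L₁ L₂ f ∧
        ∀ (α : M ≃[L₁] M) (x : M), π α (f x) = f (α x) := fun π => by
    obtain ⟨f, hf⟩ := exists_equivariant_equiv hM1 hM2 hN1 hN2 π
    exact ⟨f, isBiDefinableVia_of_equivariant hMcat hNcat (hM2 ∅ Set.finite_empty) π f hf, hf⟩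
  exact ⟨⟨fun ⟨π⟩ => (key π).imp fun _ h => h.1,
    fun ⟨_, hf⟩ => nonempty_mulEquiv_of_isBiDefinableVia hf⟩, key⟩

end PaperSSIP
end

section
/- Let M be a countable homogeneous structure with the strong small index property and locally finite algebraicity, and let G = Aut(M). Then a subgroup H ≤ G has index less than 2^ℵ₀ in G if and only if H = G_(K,L) for some pair (K, L) ∈ EA(M); that is, the set of subgroups of G of index less than 2^ℵ₀ equals SS(M). -/
open FirstOrder Cardinal

namespace PaperSSIP

variable {L : FirstOrder.Language} {M : Type*} [L.Structure M]

theorem subset_acl (A : Set M) : A ⊆ acl L A := by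
  intro a ha
  refine (Set.finite_singleton a).subset ?_
  rintro _ ⟨g, hg, rfl⟩
  exact hg a ha

/-- The algebraic closure of a set, as a substructure. -/
def aclSubstructure (L : FirstOrder.Language) {M : Type*} [L.Structure M] (A : Set M) :
    L.Substructure M where
  carrier := acl L A
  fun_mem := by
    intro n f x hx
    have hfin : (Set.univ.pi fun i => orbit (ptStab L A) (x i)).Finite :=
      Set.Finite.pi' hx |>.subset fun y hy i => hy i (Set.mem_univ i)
    refine (hfin.image (Language.Structure.funMap f)).subset ?_
    rintro _ ⟨g, hg, rfl⟩
    exact ⟨g ∘ x, fun i _ => ⟨g, hg, rfl⟩, (g.map_fun f x).symm⟩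

theorem apply_mem_acl {A : Set M} {h : M ≃[L] M} (hh : h ∈ setStab L A) {a : M}
    (ha : a ∈ acl L A) : h a ∈ acl L A := by
  refine (Set.Finite.image h ha).subset ?_
  rintro _ ⟨g, hg, rfl⟩
  refine ⟨h⁻¹ (g (h a)), ⟨h⁻¹ * g * h, fun b hb => ?_, rfl⟩, h.apply_symm_apply _⟩
  have hhb : h b ∈ A := by
    have h1 : h '' A = A := hh
    rw [← h1]
    exact Set.mem_image_of_mem h hb
  change h⁻¹ (g (h b)) = b
  rw [hg _ hhb]
  exact h.symm_apply_apply b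

/-- The automorphism that a setwise invariant substructure inherits. -/
def restrictAut (S : L.Substructure M) (f : M ≃[L] M) (hf : ∀ x ∈ S, f x ∈ S)
    (hf' : ∀ x ∈ S, f.symm x ∈ S) : S ≃[L] S where
  toFun x := ⟨f x, hf x x.2⟩
  invFun x := ⟨f.symm x, hf' x x.2⟩
  left_inv x := Subtype.ext (f.symm_apply_apply x)
  right_inv x := Subtype.ext (f.apply_symm_apply x)
  map_fun' φ x := Subtype.ext (f.map_fun φ fun i => (x i : M))
  map_rel' r x := f.map_rel r fun i => (x i : M)

/-- The group of restrictions to `S` of those members of `H` that leave `S` invariant. -/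
def restrictSubgroup (S : L.Substructure M) (H : Subgroup (M ≃[L] M)) :
    Subgroup (S ≃[L] S) where
  carrier := {e | ∃ f ∈ H, ∀ x : S, f (x : M) = (e x : M)}
  one_mem' := ⟨1, H.one_mem, fun _ => rfl⟩
  mul_mem' := by
    rintro d e ⟨f, hf, hfd⟩ ⟨g, hg, hge⟩
    refine ⟨f * g, mul_mem hf hg, fun x => ?_⟩
    rw [mul_apply, hge x]
    exact hfd (e x)
  inv_mem' := by
    rintro e ⟨f, hf, hfe⟩
    refine ⟨f⁻¹, inv_mem hf, fun x => ?_⟩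
    have h1 : f ((e⁻¹ x : S) : M) = (x : M) := by
      rw [hfe (e⁻¹ x)]
      exact congrArg _ (e.apply_symm_apply x)
    rw [← h1]
    exact f.symm_apply_apply _

theorem eq_stabIn_restrictSubgroup {A : Set M} {H : Subgroup (M ≃[L] M)}
    (hA : ptStab L A ≤ H) (hH : H ≤ setStab L A) :
    H = stabIn (aclSubstructure L A) (restrictSubgroup (aclSubstructure L A) H) := by
  refine le_antisymm (fun f hf => ?_) ?_
  · exact ⟨restrictAut _ f (fun _ hx => apply_mem_acl (hH hf) hx)
      (fun _ hx => apply_mem_acl (hH (inv_mem hf)) hx), ⟨f, hf, fun _ => rfl⟩, fun _ => rfl⟩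
  · rintro f ⟨e, ⟨h, hh, hhe⟩, hfe⟩
    have key : h⁻¹ * f ∈ ptStab L A := by
      intro a ha
      have hfa : f a = h a := (hfe ⟨a, subset_acl A ha⟩).trans (hhe ⟨a, subset_acl A ha⟩).symm
      rw [mul_apply, hfa]
      exact h.symm_apply_apply a
    simpa using mul_mem hh (hA key)

theorem ptStab_le_stabIn (S : L.Substructure M) (K : Subgroup (S ≃[L] S)) :
    ptStab L (S : Set M) ≤ stabIn S K :=
  fun _ hf => ⟨1, K.one_mem, fun x => hf x x.2⟩

theorem countable_quotient_of_ptStab_le [Countable M] {A : Set M} (hA : A.Finite)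
    {H : Subgroup (M ≃[L] M)} (hH : ptStab L A ≤ H) : Countable ((M ≃[L] M) ⧸ H) := by
  have := hA.to_subtype
  refine Function.Injective.countable (f := fun (q : (M ≃[L] M) ⧸ H) (a : A) => q.out (a : M)) ?_
  intro p q hpq
  rw [← p.out_eq', ← q.out_eq']
  refine QuotientGroup.eq.mpr (hH fun a ha => ?_)
  have h1 : q.out a = p.out a := (congrFun hpq ⟨a, ha⟩).symm
  rw [mul_apply, h1]
  exact p.out.symm_apply_apply a

/-- For a countable homogeneous structure with the strong small index property
and locally finite algebraicity, the subgroups of `Aut(M)` of index less than the continuum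
are exactly the members of `𝒮𝒮(M)`. -/
theorem statement_4 {L : FirstOrder.Language} {M : Type*} [L.Structure M]
    [Countable M] [Countable L.Symbols]
    (hhom : L.IsUltrahomogeneous M) (hssip : HasSSIP L M) (hlf : LocFinAlg L M)
    (H : Subgroup (M ≃[L] M)) :
    SmallIndex H ↔ H ∈ SS L M := by
  constructor
  · intro hH
    obtain ⟨A, hfin, hA, hA'⟩ := hssip H hH
    exact ⟨_, _, ⟨A, hfin, rfl⟩, eq_stabIn_restrictSubgroup hA hA'⟩
  · rintro ⟨S, K, ⟨B, hB, hS⟩, rfl⟩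
    have hfin : (S : Set M).Finite := hS ▸ hlf B hB
    have := countable_quotient_of_ptStab_le hfin (ptStab_le_stabIn S K)
    exact Cardinal.mk_le_aleph0.trans_lt Cardinal.aleph0_lt_continuum

end PaperSSIP
end

section
/- Let M be a countable homogeneous structure with the strong small index property and locally finite algebraicity, and G = Aut(M). Then the map (K, L) ↦ G_(K,L) from EA(M) to the set of subgroups of G is injective: if (K₁, L₁), (K₂, L₂) ∈ EA(M) and G_(K₁,L₁) = G_(K₂,L₂), then K₁ = K₂ and L₁ = L₂. -/
open FirstOrder Cardinal

namespace PaperSSIP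

variable {L : FirstOrder.Language} {M : Type*} [L.Structure M]

theorem apply_mem_acl_s9 {B : Set M} {g : M ≃[L] M} (hg : g ∈ ptStab L B) {a : M}
    (ha : a ∈ acl L B) : g a ∈ acl L B := by
  refine Set.Finite.subset (s := orbit (ptStab L B) a) ha ?_
  rintro b ⟨f, hf, rfl⟩
  exact ⟨f * g, mul_mem hf hg, rfl⟩

/-- Algebraic closure is idempotent as long as it is finite. -/
theorem acl_acl_subset {B : Set M} (hfin : (acl L B).Finite) :
    acl L (acl L B) ⊆ acl L B := by
  intro x hx
  have : Finite (acl L B) := hfin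
  let r : (M ≃[L] M) → (acl L B → M) := fun g a => g a
  have hR : (r '' (ptStab L B : Set (M ≃[L] M))).Finite := by
    refine (Set.Finite.pi' fun _ : acl L B => hfin).subset ?_
    rintro _ ⟨g, hg, rfl⟩ a
    exact apply_mem_acl_s9 hg a.2
  have hfib : ∀ ρ ∈ r '' (ptStab L B : Set (M ≃[L] M)),
      {y | ∃ g ∈ ptStab L B, r g = ρ ∧ g x = y}.Finite := by
    rintro _ ⟨g₀, -, rfl⟩
    refine (Set.Finite.image g₀ (s := orbit (ptStab L (acl L B)) x) hx).subset ?_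
    rintro _ ⟨g, -, hgr, rfl⟩
    refine ⟨(g₀⁻¹ * g) x, ⟨g₀⁻¹ * g, fun a ha => ?_, rfl⟩, g₀.apply_symm_apply (g x)⟩
    have hga : g a = g₀ a := congrFun hgr ⟨a, ha⟩
    rw [mul_apply, hga]
    exact g₀.symm_apply_apply a
  refine (hR.biUnion hfib).subset ?_
  rintro _ ⟨g, hg, rfl⟩
  exact Set.mem_biUnion ⟨g, hg, rfl⟩ ⟨g, hg, rfl, rfl⟩

theorem subset_acl_of_stabIn_le {S₁ S₂ : L.Substructure M} {L₁ : Subgroup (↥S₁ ≃[L] ↥S₁)}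
    {L₂ : Subgroup (↥S₂ ≃[L] ↥S₂)} (hfin : (S₂ : Set M).Finite)
    (h : stabIn S₁ L₁ ≤ stabIn S₂ L₂) : (S₂ : Set M) ⊆ acl L (S₁ : Set M) := by
  intro x hx
  refine hfin.subset ?_
  rintro _ ⟨g, hg, rfl⟩
  have hgs : g ∈ stabIn S₁ L₁ := ⟨1, L₁.one_mem, fun a => hg a a.2⟩
  obtain ⟨e, -, he⟩ := h hgs
  rw [he ⟨x, hx⟩]
  exact (e ⟨x, hx⟩).2

theorem memA.finite (hlf : LocFinAlg L M) {S : L.Substructure M} (hS : memA L S) :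
    (S : Set M).Finite := by
  obtain ⟨B, hB, hSB⟩ := hS
  exact hSB ▸ hlf B hB

theorem memA.acl_subset (hlf : LocFinAlg L M) {S : L.Substructure M} (hS : memA L S) :
    acl L (S : Set M) ⊆ S := by
  obtain ⟨B, hB, hSB⟩ := hS
  rw [hSB]
  exact acl_acl_subset (hlf B hB)

theorem le_of_stabIn_le (hhom : L.IsUltrahomogeneous M) {S : L.Substructure M}
    (hfin : (S : Set M).Finite) {L₁ L₂ : Subgroup (↥S ≃[L] ↥S)}
    (h : stabIn S L₁ ≤ stabIn S L₂) : L₁ ≤ L₂ := by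
  intro e he
  have hfg : S.FG := by
    simpa using Language.Substructure.fg_closure hfin (L := L)
  obtain ⟨g, hg⟩ := hhom S hfg (S.subtype.comp e.toEmbedding)
  have hge : ∀ x : S, g (x : M) = (e x : M) := fun x => (DFunLike.congr_fun hg x).symm
  obtain ⟨f, hf, hgf⟩ := h (show g ∈ stabIn S L₁ from ⟨e, he, hge⟩)
  have hef : e = f := by
    ext x
    rw [← hge x, hgf x]
  exact hef ▸ hf

/-- The map `(K, L') ↦ G_(K,L')` on `𝐄𝐀(M)` is injective. -/
theorem statement_9 {L : FirstOrder.Language} {M : Type*} [L.Structure M]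
    [Countable M] [Countable L.Symbols]
    (hhom : L.IsUltrahomogeneous M) (hssip : HasSSIP L M) (hlf : LocFinAlg L M)
    {S₁ S₂ : L.Substructure M} (L₁ : Subgroup (↥S₁ ≃[L] ↥S₁)) (L₂ : Subgroup (↥S₂ ≃[L] ↥S₂))
    (h₁ : memA L S₁) (h₂ : memA L S₂)
    (h : stabIn S₁ L₁ = stabIn S₂ L₂) :
    ∃ hS : S₁ = S₂, hS ▸ L₁ = L₂ := by
  have hS : S₁ = S₂ := SetLike.coe_injective <| Set.Subset.antisymm
    ((subset_acl_of_stabIn_le (h₁.finite hlf) h.ge).trans (h₂.acl_subset hlf))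
    ((subset_acl_of_stabIn_le (h₂.finite hlf) h.le).trans (h₁.acl_subset hlf))
  subst hS
  exact ⟨rfl, le_antisymm (le_of_stabIn_le hhom (h₁.finite hlf) h.le)
    (le_of_stabIn_le hhom (h₁.finite hlf) h.ge)⟩

end PaperSSIP
end
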